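/- Let f, g be probability densities on ℝ with p = f ⋆ g, and suppose the function F(y) = (2π)⁻¹ ∫ e^{-iyu} Φ(u)/conj(Φ^g(u)) du is well defined (Φ/conj(Φ^g) ∈ L¹). Then ∫ F(y) p(y) dy = ∫ f(x)² dx. -/

import Mathlib

open MeasureTheory Real

open scoped FourierTransform ContDiff Convolution in
lemma aux_flip (a b : ℝ → ℂ) (ha : Integrable a) (hb : Integrable b) :
    ∫ x, 𝓕 a x • b x = ∫ x, a x • 𝓕 b x := by
  have := VectorFourier.integral_fourierIntegral_smul_eq_flip (μ := volume) (ν := volume)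
    (L := innerₗ ℝ) (f := a) (g := b) Real.continuous_fourierChar
    (by exact continuous_inner) ha hb
  rw [flip_innerₗ] at this
  exact this

open scoped FourierTransform in
lemma aux_cont (a : ℝ → ℂ) (ha : Integrable a) : Continuous (𝓕 a) :=
  VectorFourier.fourierIntegral_continuous Real.continuous_fourierChar
    (L := innerₗ ℝ) (by exact continuous_inner) ha

open scoped FourierTransform ContDiff SchwartzMap in
lemma aux_inv (a : ℝ → ℂ) (ha : Integrable a) (hFa : Integrable (𝓕 a)) :
    ∀ᵐ x, a x = 𝓕⁻ (𝓕 a) x := by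
  have hneg : Integrable (fun x => 𝓕 a (-x)) := hFa.comp_neg
  refine ae_eq_of_integral_contDiff_smul_eq ha.locallyIntegrable ?_ ?_
  · rw [Real.fourierInv_eq_fourier_comp_neg]
    exact (aux_cont _ hneg).locallyIntegrable
  · intro g hg hgc
    have hgc' : HasCompactSupport (fun x => (g x : ℂ)) :=
      hgc.comp_left (g := fun r : ℝ => (r : ℂ)) (by simp)
    have hg' : ContDiff ℝ ∞ (fun x => (g x : ℂ)) := Complex.ofRealCLM.contDiff.comp hg
    let φ : 𝓢(ℝ, ℂ) := hgc'.toSchwartzMap hg'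
    have h1 : ∫ x, g x • a x = ∫ x, 𝓕 (𝓕⁻ φ) x • a x := by
      rw [FourierTransform.fourier_fourierInv_eq]
      simp [φ]
    have h2 : ∫ x, 𝓕 (𝓕⁻ φ) x • a x = ∫ x, 𝓕⁻ φ x • 𝓕 a x := by
      rw [SchwartzMap.fourier_coe]
      exact aux_flip _ _ (𝓕⁻ φ).integrable ha
    have h3 : ∫ x, g x • 𝓕⁻ (𝓕 a) x = ∫ x, 𝓕 φ x • 𝓕 a (-x) := by
      rw [SchwartzMap.fourier_coe, aux_flip _ _ φ.integrable hneg,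
        Real.fourierInv_eq_fourier_comp_neg]
      simp [φ]
    rw [h1, h2, h3, ← integral_neg_eq_self]
    congr 1
    ext x
    rw [SchwartzMap.fourier_coe, SchwartzMap.fourierInv_coe, Real.fourierInv_eq_fourier_neg,
      neg_neg]

lemma aux_exp_norm (x y : ℝ) : ‖Complex.exp (-Complex.I * (x : ℂ) * (y : ℂ))‖ = 1 := by
  have : -Complex.I * (x : ℂ) * (y : ℂ) = ((-(x * y) : ℝ) : ℂ) * Complex.I := by
    push_cast; ring
  rw [this, Complex.norm_exp_ofReal_mul_I]

lemma aux_swap (A q : ℝ → ℂ) (hA : Integrable A) (hq : Integrable q) :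
    ∫ y : ℝ, (∫ u : ℝ, Complex.exp (-Complex.I * (y : ℂ) * (u : ℂ)) * A u) * q y =
      ∫ u : ℝ, A u * ∫ y : ℝ, Complex.exp (-Complex.I * (y : ℂ) * (u : ℂ)) * q y := by
  simp_rw [← integral_mul_const, ← integral_const_mul]
  rw [integral_integral_swap]
  · congr 1; ext u; congr 1; ext y; ring
  · have h := (hq.mul_prod hA).bdd_mul (c := 1)
      (f := fun z : ℝ × ℝ => Complex.exp (-Complex.I * (z.1 : ℂ) * (z.2 : ℂ)))
      (by
        apply Continuous.aestronglyMeasurable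
        fun_prop)
      (Filter.Eventually.of_forall fun z => (aux_exp_norm z.1 z.2).le)
    refine h.congr (Filter.Eventually.of_forall fun z => ?_)
    simp only [Function.uncurry]
    ring

lemma aux_conj (f : ℝ → ℝ) (u : ℝ) :
    (starRingEnd ℂ) (∫ (x : ℝ), Complex.exp (Complex.I * (u : ℂ) * (x : ℂ)) * (f x : ℂ)) =
    ∫ y : ℝ, Complex.exp (-Complex.I * (y : ℂ) * (u : ℂ)) * (f y : ℂ) := by
  rw [← integral_conj]
  congr 1; ext x
  rw [map_mul, ← Complex.exp_conj]
  simp only [map_mul, Complex.conj_I, Complex.conj_ofReal]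
  congr 2; ring

lemma aux_int (q : ℝ → ℂ) (hq : Integrable q) (u : ℝ) :
    Integrable (fun y : ℝ => Complex.exp (-Complex.I * (y : ℂ) * (u : ℂ)) * q y) := by
  refine hq.bdd_mul (c := 1) ?_ (Filter.Eventually.of_forall fun z => (aux_exp_norm z u).le)
  apply Continuous.aestronglyMeasurable
  fun_prop

open scoped Convolution in
lemma aux_conv_int (f g : ℝ → ℂ) (hf : Integrable f) (hg : Integrable g) :
    Integrable (fun x => ∫ y, f (x - y) * g y) := by
  have := hg.integrable_convolution (ContinuousLinearMap.mul ℝ ℂ) hf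
  refine this.congr (Filter.Eventually.of_forall fun x => ?_)
  simp only [convolution, ContinuousLinearMap.mul_apply']
  congr 1; ext y; ring

lemma aux_conv (f g : ℝ → ℂ) (hf : Integrable f) (hg : Integrable g) (u : ℝ) :
    ∫ x : ℝ, Complex.exp (-Complex.I * (x : ℂ) * (u : ℂ)) * (∫ y, f (x - y) * g y) =
    (∫ y : ℝ, Complex.exp (-Complex.I * (y : ℂ) * (u : ℂ)) * f y) *
    (∫ y : ℝ, Complex.exp (-Complex.I * (y : ℂ) * (u : ℂ)) * g y) := by
  have := integral_convolution (ContinuousLinearMap.mul ℝ ℂ) (aux_int g hg u) (aux_int f hf u)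
  rw [ContinuousLinearMap.mul_apply'] at this
  rw [mul_comm (∫ y : ℝ, _), ← this]
  congr 1; ext x
  rw [← integral_const_mul]
  simp only [convolution, ContinuousLinearMap.mul_apply']
  congr 1; ext y
  have : Complex.exp (-Complex.I * (x : ℂ) * (u : ℂ)) =
    Complex.exp (-Complex.I * (y : ℂ) * (u : ℂ)) *
      Complex.exp (-Complex.I * ((x - y : ℝ) : ℂ) * (u : ℂ)) := by
    rw [← Complex.exp_add]; congr 1; push_cast; ring
  rw [this]; ring

/-- Parseval identity: ∫ F p = ∫ f², where p = f ⋆ g and F is the inverse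
Fourier transform of Φ/conj(Φ^g). -/
theorem stmt_3 (f g p : ℝ → ℝ)
    (hf_nonneg : ∀ x, 0 ≤ f x) (hf_prob : ∫ x, f x = 1)
    (hg_nonneg : ∀ x, 0 ≤ g x) (hg_prob : ∫ x, g x = 1)
    (hp : ∀ x, p x = ∫ y, f (x - y) * g y)
    (Φ Φg : ℝ → ℂ)
    (hΦ : ∀ u, Φ u = ∫ (x : ℝ), Complex.exp (Complex.I * (u : ℂ) * (x : ℂ)) * (f x : ℂ))
    (hΦg : ∀ u, Φg u = ∫ (x : ℝ), Complex.exp (Complex.I * (u : ℂ) * (x : ℂ)) * (g x : ℂ))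
    (hΦg_ne : ∀ u, Φg u ≠ 0)
    (hInt : Integrable (fun u => Φ u / (starRingEnd ℂ) (Φg u)) volume)
    (F : ℝ → ℂ)
    (hF : ∀ y, F y = ((2 * Real.pi : ℝ) : ℂ)⁻¹ *
      ∫ (u : ℝ), Complex.exp (-Complex.I * (y : ℂ) * (u : ℂ)) *
        (Φ u / (starRingEnd ℂ) (Φg u))) :
    ∫ (y : ℝ), F y * (p y : ℂ) = ∫ (x : ℝ), ((f x : ℂ)) ^ 2 := by
  have hf : Integrable f := by
    by_contra h
    rw [integral_undef h] at hf_prob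
    norm_num at hf_prob
  have hg : Integrable g := by
    by_contra h
    rw [integral_undef h] at hg_prob
    norm_num at hg_prob
  have hfc : Integrable (fun x => (f x : ℂ)) := hf.ofReal
  have hgc : Integrable (fun x => (g x : ℂ)) := hg.ofReal
  have hpc : (fun x => (p x : ℂ)) = fun x => ∫ y, (f (x - y) : ℂ) * (g y : ℂ) := by
    ext x
    rw [hp, ← integral_complex_ofReal]
    simp
  have hpi : Integrable (fun x => (p x : ℂ)) := by
    rw [hpc]; exact aux_conv_int _ _ hfc hgc
  -- the Fourier transform in Mathlib normalisation
  have hFou : ∀ w : ℝ, FourierTransform.fourier (fun x => (f x : ℂ)) w = Φ (-(2 * π) * w) := by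
    intro w
    rw [Real.fourier_real_eq_integral_exp_smul, hΦ]
    congr 1; ext x
    rw [smul_eq_mul]
    congr 2; push_cast; ring
  have hpi0 : (-(2 * π)) ≠ 0 := by
    have := Real.pi_pos
    linarith
  have hΦc : Continuous Φ := by
    have h := (aux_cont _ hfc).comp (continuous_const_mul ((-(2 * π))⁻¹))
    convert h using 1
    ext u
    rw [Function.comp_apply, hFou, mul_inv_cancel_left₀ hpi0]
  have hΦg1 : ∀ u, ‖Φg u‖ ≤ 1 := by
    intro u
    rw [hΦg, ← hg_prob]
    refine (norm_integral_le_integral_norm _).trans (le_of_eq ?_)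
    congr 1; ext x
    have := aux_exp_norm (-u) x
    have h2 : -Complex.I * ((-u : ℝ) : ℂ) * (x : ℂ) = Complex.I * u * x := by push_cast; ring
    rw [h2] at this
    rw [norm_mul, this, one_mul, Complex.norm_real, Real.norm_of_nonneg (hg_nonneg x)]
  have hΦi : Integrable Φ := by
    refine hInt.mono hΦc.aestronglyMeasurable (Filter.Eventually.of_forall fun u => ?_)
    rw [norm_div, RCLike.norm_conj]
    exact le_div_self (norm_nonneg _) (norm_pos_iff.2 (hΦg_ne u)) (hΦg1 u)
  have hFi : Integrable (FourierTransform.fourier (fun x => (f x : ℂ))) := by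
    rw [funext hFou]
    exact hΦi.comp_mul_left' hpi0
  have hinv : ∀ᵐ x, (f x : ℂ) = ((2 * Real.pi : ℝ) : ℂ)⁻¹ *
      ∫ (u : ℝ), Complex.exp (-Complex.I * (x : ℂ) * (u : ℂ)) * Φ u := by
    filter_upwards [aux_inv _ hfc hFi] with x hx
    rw [hx, Real.fourierInv_eq']
    have h := Measure.integral_comp_mul_left
      (fun u : ℝ => Complex.exp (-Complex.I * (x : ℂ) * (u : ℂ)) * Φ u) (-(2 * π))
    have h3 : |(-(2 * π))⁻¹| = (2 * π)⁻¹ := by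
      rw [abs_inv, abs_neg, abs_of_pos Real.two_pi_pos]
    rw [h3, Complex.real_smul, Complex.ofReal_inv] at h
    rw [← h]
    congr 1; ext v
    rw [hFou, smul_eq_mul]
    congr 2
    simp
    ring
  have e1 : ∫ (y : ℝ), F y * (p y : ℂ) = ((2 * Real.pi : ℝ) : ℂ)⁻¹ *
      ∫ u, Φ u * (starRingEnd ℂ) (Φ u) := by
    simp_rw [hF, mul_assoc (((2 * Real.pi : ℝ) : ℂ)⁻¹)]
    rw [integral_const_mul, aux_swap _ _ hInt hpi]
    congr 2; ext u
    have h := aux_conv _ _ hfc hgc u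
    rw [← aux_conj, ← aux_conj, ← hΦ, ← hΦg] at h
    have h4 : ∀ x : ℝ, (p x : ℂ) = ∫ y, (f (x - y) : ℂ) * (g y : ℂ) := fun x => congrFun hpc x
    simp_rw [h4]
    rw [h]
    have : (starRingEnd ℂ) (Φg u) ≠ 0 := by simpa using hΦg_ne u
    field_simp
  have e2 : ∫ (x : ℝ), ((f x : ℂ)) ^ 2 = ((2 * Real.pi : ℝ) : ℂ)⁻¹ *
      ∫ u, Φ u * (starRingEnd ℂ) (Φ u) := by
    have h5 : ∫ (x : ℝ), ((f x : ℂ)) ^ 2 = ∫ x : ℝ, (((2 * Real.pi : ℝ) : ℂ)⁻¹ *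
      ∫ (u : ℝ), Complex.exp (-Complex.I * (x : ℂ) * (u : ℂ)) * Φ u) * (f x : ℂ) := by
      apply integral_congr_ae
      filter_upwards [hinv] with x hx
      rw [← hx, sq]
    rw [h5]
    simp_rw [mul_assoc (((2 * Real.pi : ℝ) : ℂ)⁻¹)]
    rw [integral_const_mul, aux_swap _ _ hΦi hfc]
    simp_rw [← aux_conj, ← hΦ]
  rw [e1, e2]
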